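/- For the blow-up S_6 of ℙ² in 6 points in general position (the smooth cubic surface), Peyre's constant is α(S_6) = 1/120; that is, 7 · vol{x ∈ ℝ⁷ : B(E, x) ≥ 0 for every (−1)-class E, and 0 ≤ B(−K_6, x) ≤ 1} = 1/120, where vol is the standard Lebesgue measure on ℝ⁷. -/

import Mathlib

open scoped BigOperators
open MeasureTheory

/-- Intersection form on `ℤ^(n+1)` with basis `H, E₁, …, E_n`:
`B(x,y) = x₀y₀ - x₁y₁ - ⋯ - x_n y_n` (written as `2x₀y₀ - ∑ᵢ xᵢyᵢ`). -/
def interZ {n : ℕ} (x y : Fin (n + 1) → ℤ) : ℤ :=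
  2 * x 0 * y 0 - ∑ i, x i * y i

/-- The real intersection form on `ℝ^(n+1)`. -/
def interR {n : ℕ} (x y : Fin (n + 1) → ℝ) : ℝ :=
  2 * x 0 * y 0 - ∑ i, x i * y i

/-- The anticanonical class `-K = (3, -1, …, -1)`. -/
def antiK (n : ℕ) : Fin (n + 1) → ℤ := fun i => if i = 0 then 3 else -1

/-- The anticanonical class as a real vector. -/
def antiKR (n : ℕ) : Fin (n + 1) → ℝ := fun i => if i = 0 then 3 else -1

/-- A `(-1)`-class: `B(E,E) = -1` and `B(-K,E) = 1`. -/
def IsMinusOneClass {n : ℕ} (E : Fin (n + 1) → ℤ) : Prop :=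
  interZ E E = -1 ∧ interZ (antiK n) E = 1

/-- The nef cone: real vectors pairing nonnegatively with every `(-1)`-class. -/
def NefCone (n : ℕ) : Set (Fin (n + 1) → ℝ) :=
  {x | ∀ E : Fin (n + 1) → ℤ, IsMinusOneClass E → 0 ≤ interR (fun i => (E i : ℝ)) x}

/-- The finite list of `(-1)`-classes for at most six points: the exceptional divisors, the lines
through two points and the conics through five points. -/
def minusOneClasses (n : ℕ) : Finset (Fin (n + 1) → ℤ) :=
  (Finset.univ.image fun i : Fin n => Fin.cons 0 (Pi.single i 1)) ∪
  ((Finset.univ.powersetCard 2).image fun S : Finset (Fin n) =>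
    Fin.cons 1 fun i => if i ∈ S then -1 else 0) ∪
  ((Finset.univ.powersetCard 5).image fun S : Finset (Fin n) =>
    Fin.cons 2 fun i => if i ∈ S then -1 else 0)

lemma isMinusOneClass_cons {n : ℕ} (d : ℤ) (v : Fin n → ℤ) :
    IsMinusOneClass (Fin.cons d v : Fin (n + 1) → ℤ) ↔
      ∑ i, v i ^ 2 = d ^ 2 + 1 ∧ ∑ i, v i = 1 - 3 * d := by
  simp only [IsMinusOneClass, interZ, antiK, Fin.sum_univ_succ, Fin.cons_zero, Fin.cons_succ,
    if_true, Fin.succ_ne_zero, if_false, neg_one_mul, Finset.sum_neg_distrib, pow_two]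
  constructor <;> rintro ⟨h₁, h₂⟩ <;> constructor <;> linarith

lemma exists_neg_indicator_eq {n k : ℕ} {v : Fin n → ℤ} (h : ∑ i, v i ^ 2 = k)
    (h' : ∑ i, v i = -k) :
    ∃ S ∈ (Finset.univ.powersetCard k : Finset (Finset (Fin n))),
      (fun i => if i ∈ S then (-1 : ℤ) else 0) = v := by
  have h0 : ∑ i, (v i ^ 2 + v i) = 0 := by rw [Finset.sum_add_distrib, h, h']; ring
  have hv : ∀ i, v i = 0 ∨ v i = -1 := by
    intro i
    have := (Finset.sum_eq_zero_iff_of_nonneg (fun i _ => by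
      rcases le_or_gt 0 (v i) with h | h <;> nlinarith)).1 h0 i (Finset.mem_univ i)
    have h2 : v i * (v i + 1) = 0 := by linarith
    rcases mul_eq_zero.1 h2 with h | h
    · exact .inl h
    · exact .inr (by linarith)
  have hS : (fun i => if i ∈ Finset.univ.filter (v · = -1) then (-1 : ℤ) else 0) = v := by
    funext i
    rcases hv i with h | h <;> simp [h]
  refine ⟨_, ?_, hS⟩
  rw [Finset.mem_powersetCard]
  refine ⟨Finset.subset_univ _, ?_⟩
  rw [← hS] at h'
  simp only [Finset.sum_ite_mem, Finset.univ_inter, Finset.sum_const] at h'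
  simp at h'
  exact_mod_cast h'

lemma mem_minusOneClasses {n : ℕ} (hn : n ≤ 6) {E : Fin (n + 1) → ℤ} :
    E ∈ minusOneClasses n ↔ IsMinusOneClass E := by
  cases E using Fin.consCases with | _ d v =>
  rw [isMinusOneClass_cons]
  constructor
  · simp only [minusOneClasses, Finset.mem_union, Finset.mem_image, Finset.mem_univ, true_and,
      Finset.mem_powersetCard_univ, Fin.cons_inj]
    rintro ((⟨i, rfl, rfl⟩ | ⟨S, hS, rfl, rfl⟩) | ⟨S, hS, rfl, rfl⟩)
    · simp [Pi.single_apply]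
    all_goals simp [ite_pow, Finset.sum_ite_mem, hS]
  · rintro ⟨h₂, h₁⟩
    have hcs : (∑ i, v i) ^ 2 ≤ n * ∑ i, v i ^ 2 := by
      simpa using sq_sum_le_card_mul_sum_sq (s := Finset.univ) (f := v)
    rw [h₁, h₂] at hcs
    have hn' : (n : ℤ) ≤ 6 := by exact_mod_cast hn
    have hd : 3 * d ^ 2 - 6 * d - 5 ≤ 0 := by nlinarith [sq_nonneg d]
    have hd0 : 0 ≤ d := by by_contra! h; nlinarith
    have hd2 : d ≤ 2 := by by_contra! h; nlinarith
    simp only [minusOneClasses, Finset.mem_union, Finset.mem_image, Fin.cons_inj]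
    interval_cases d
    · obtain ⟨S, hS, h⟩ := exists_neg_indicator_eq (n := n) (k := 1) (v := -v)
        (by simpa using h₂) (by simpa using h₁)
      obtain ⟨i, rfl⟩ := Finset.card_eq_one.1 (Finset.mem_powersetCard.1 hS).2
      refine .inl (.inl ⟨i, Finset.mem_univ _, rfl, ?_⟩)
      rw [← neg_neg v, ← h]
      funext j
      by_cases hj : j = i <;> simp [hj]
    · obtain ⟨S, hS, h⟩ := exists_neg_indicator_eq (n := n) (k := 2) (v := v)
        (by simpa using h₂) (by simpa using h₁)
      exact .inl (.inr ⟨S, hS, rfl, h⟩)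
    · obtain ⟨S, hS, h⟩ := exists_neg_indicator_eq (n := n) (k := 5) (v := v)
        (by simpa using h₂) (by simpa using h₁)
      exact .inr ⟨S, hS, rfl, h⟩

lemma volume_pyramid {k : ℕ} {C : Set (Fin k → ℝ)} (hC : MeasurableSet C)
    (hsmul : ∀ s : ℝ, 0 < s → ∀ y ∈ C, s • y ∈ C) {l : (Fin k → ℝ) → ℝ} (hl : Measurable l)
    (hls : ∀ (s : ℝ) y, l (s • y) = s * l y) (hl0 : ∀ y ∈ C, 0 ≤ l y) (w : Fin k → ℝ)
    {c : ℝ} (hc : 0 < c) :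
    volume {x : Fin (k + 1) → ℝ | x (Fin.last k) ≤ 0 ∧
        (fun i => x (Fin.castSucc i) + x (Fin.last k) * w i) ∈ C ∧
        l (fun i => x (Fin.castSucc i) + x (Fin.last k) * w i) ≤ 1 + c * x (Fin.last k)} =
      ENNReal.ofReal (1 / (c * (k + 1))) * volume {y | y ∈ C ∧ l y ≤ 1} := by
  set T : Set (ℝ × (Fin k → ℝ)) := {p | p.1 ≤ 0 ∧ p.2 + p.1 • w ∈ C ∧
    l (p.2 + p.1 • w) ≤ 1 + c * p.1} with hT
  have hTm : MeasurableSet T := by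
    have hm : Measurable fun p : ℝ × (Fin k → ℝ) => p.2 + p.1 • w := by fun_prop
    exact (measurableSet_le measurable_fst measurable_const).inter
      ((hm hC).inter (measurableSet_le (hl.comp hm) (by fun_prop)))
  have hpre : {x : Fin (k + 1) → ℝ | x (Fin.last k) ≤ 0 ∧
        (fun i => x (Fin.castSucc i) + x (Fin.last k) * w i) ∈ C ∧
        l (fun i => x (Fin.castSucc i) + x (Fin.last k) * w i) ≤ 1 + c * x (Fin.last k)} =
      MeasurableEquiv.piFinSuccAbove (fun _ => ℝ) (Fin.last k) ⁻¹' T := by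
    have : ∀ x : Fin (k + 1) → ℝ, (MeasurableEquiv.piFinSuccAbove (fun _ => ℝ) (Fin.last k) x).2 +
        (MeasurableEquiv.piFinSuccAbove (fun _ => ℝ) (Fin.last k) x).1 • w =
        fun i => x (Fin.castSucc i) + x (Fin.last k) * w i := by
      intro x
      funext i
      simp [MeasurableEquiv.piFinSuccAbove, Fin.init]
    ext x
    simp only [Set.mem_ofPred_eq, Set.mem_preimage, hT, this]
    rfl
  have hslice : ∀ u : ℝ, volume (Prod.mk u ⁻¹' T) =
      volume {y | u ≤ 0 ∧ y ∈ C ∧ l y ≤ 1 + c * u} := fun u =>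
    measure_preimage_add_right volume (u • w) {y | u ≤ 0 ∧ y ∈ C ∧ l y ≤ 1 + c * u}
  set V := volume {y | y ∈ C ∧ l y ≤ 1}
  have hae : ∀ᵐ u : ℝ, volume (Prod.mk u ⁻¹' T) =
      (Set.Ioc (-c⁻¹) 0).indicator (fun u => ENNReal.ofReal ((1 + c * u) ^ k) * V) u := by
    filter_upwards [compl_mem_ae_iff.2 (measure_singleton (μ := volume) (-c⁻¹))] with u hu
    rw [hslice]
    by_cases hu' : u ∈ Set.Ioc (-c⁻¹) 0
    · have hs : 0 < 1 + c * u := by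
        have := mul_lt_mul_of_pos_left hu'.1 hc
        rw [mul_neg, mul_inv_cancel₀ hc.ne'] at this
        linarith
      rw [Set.indicator_of_mem hu', ← abs_of_pos (pow_pos hs k)]
      have := Measure.addHaar_smul (volume : Measure (Fin k → ℝ)) (1 + c * u) {y | y ∈ C ∧ l y ≤ 1}
      rw [Module.finrank_fin_fun] at this
      rw [← this]
      congr 1
      ext y
      rw [Set.mem_smul_set_iff_inv_smul_mem₀ hs.ne']
      simp only [Set.mem_ofPred_eq, hls, hu'.2, true_and, inv_mul_le_iff₀ hs, mul_one]
      refine and_congr_left fun _ => ⟨hsmul _ (inv_pos.2 hs) y, fun h => ?_⟩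
      simpa [smul_smul, mul_inv_cancel₀ hs.ne'] using hsmul _ hs _ h
    · rw [Set.indicator_of_notMem hu']
      convert! measure_empty (μ := (volume : Measure (Fin k → ℝ)))
      refine Set.eq_empty_iff_forall_notMem.2 ?_
      rintro y ⟨h0, hy, hly⟩
      refine hu' ⟨lt_of_le_of_ne ?_ (Ne.symm hu), h0⟩
      have := (hl0 y hy).trans hly
      rw [neg_le, inv_eq_one_div, le_div_iff₀ hc]
      linarith
  have hint : ∫ u in Set.Ioc (-c⁻¹) 0, (1 + c * u) ^ k = 1 / (c * (k + 1)) := by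
    rw [← intervalIntegral.integral_of_le (by simpa using hc.le),
      intervalIntegral.integral_comp_add_mul (fun x => x ^ k) hc.ne']
    simp [hc.ne']
    ring
  rw [hpre, (volume_preserving_piFinSuccAbove (fun _ => ℝ) (Fin.last k)).measure_preimage_equiv,
    Measure.volume_eq_prod, Measure.prod_apply hTm, lintegral_congr_ae hae,
    lintegral_indicator measurableSet_Ioc, lintegral_mul_const _ (by fun_prop), ← hint,
    ofReal_integral_eq_lintegral_ofReal]
  · exact (Continuous.integrableOn_Icc (by fun_prop)).mono_set Set.Ioc_subset_Icc_self
  · filter_upwards [ae_restrict_mem measurableSet_Ioc] with u hu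
    have := mul_lt_mul_of_pos_left hu.1 hc
    rw [mul_neg, mul_inv_cancel₀ hc.ne'] at this
    exact pow_nonneg (by linarith) k

section IntersectionForm

variable {n : ℕ}

lemma interR_comm (x y : Fin (n + 1) → ℝ) : interR x y = interR y x := by
  simp only [interR, mul_comm, mul_left_comm]

/-- Pairing with a fixed class, as a linear form. -/
def interRForm (a : Fin (n + 1) → ℝ) : (Fin (n + 1) → ℝ) →ₗ[ℝ] ℝ where
  toFun := interR a
  map_add' x y := by
    simp only [interR, Pi.add_apply, mul_add, Finset.sum_add_distrib]; ring
  map_smul' c x := by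
    simp only [interR, Pi.smul_apply, smul_eq_mul, RingHom.id_apply, mul_left_comm _ c,
      ← Finset.mul_sum]; ring

lemma interR_add_right (a x y : Fin (n + 1) → ℝ) :
    interR a (x + y) = interR a x + interR a y := (interRForm a).map_add x y

lemma interR_smul_right (a : Fin (n + 1) → ℝ) (c : ℝ) (x : Fin (n + 1) → ℝ) :
    interR a (c • x) = c * interR a x := (interRForm a).map_smul c x

lemma interR_add_left (x y a : Fin (n + 1) → ℝ) :
    interR (x + y) a = interR x a + interR y a := by
  simp only [interR_comm _ a, interR_add_right]

lemma interR_smul_left (c : ℝ) (x a : Fin (n + 1) → ℝ) :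
    interR (c • x) a = c * interR x a := by
  simp only [interR_comm _ a, interR_smul_right]

lemma continuous_interR (a : Fin (n + 1) → ℝ) : Continuous (interR a) := by
  unfold interR; fun_prop

lemma interR_intCast (E F : Fin (n + 1) → ℤ) :
    interR (fun i => (E i : ℝ)) (fun i => (F i : ℝ)) = interZ E F := by
  simp [interR, interZ]

lemma antiK_intCast : (fun i => (antiK n i : ℝ)) = antiKR n := by
  funext i
  simp only [antiK, antiKR]
  split_ifs <;> simp

lemma eq_of_interR_eq {a b : Fin (n + 1) → ℝ} (h : ∀ x, interR a x = interR b x) : a = b := by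
  funext i
  have := h (Pi.single i 1)
  by_cases hi : i = 0
  · subst hi
    simp [interR, Pi.single_apply] at this
    linarith
  · simpa [interR, Pi.single_apply, Ne.symm hi] using this

/-- The reflection `x ↦ x + B(α, x) α`, isometric when `B(α, α) = -2`. -/
def reflect (α : Fin (n + 1) → ℝ) : (Fin (n + 1) → ℝ) →ₗ[ℝ] (Fin (n + 1) → ℝ) :=
  LinearMap.id + (interRForm α).smulRight α

lemma reflect_apply (α x : Fin (n + 1) → ℝ) : reflect α x = x + interR α x • α := rfl

lemma reflect_reflect {α : Fin (n + 1) → ℝ} (h : interR α α = -2) (x : Fin (n + 1) → ℝ) :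
    reflect α (reflect α x) = x := by
  simp only [reflect_apply, interR_add_right, interR_smul_right, h]
  module

lemma interR_reflect (α x y : Fin (n + 1) → ℝ) :
    interR x (reflect α y) = interR (reflect α x) y := by
  simp only [reflect_apply, interR_add_right, interR_smul_right, interR_add_left,
    interR_smul_left, interR_comm x α]
  ring

lemma volume_preimage_reflect {α : Fin (n + 1) → ℝ} (h : interR α α = -2)
    (s : Set (Fin (n + 1) → ℝ)) : volume (reflect α ⁻¹' s) = volume s := by
  have hdet : LinearMap.det (reflect α) * LinearMap.det (reflect α) = 1 := by
    rw [← LinearMap.det_comp, ← LinearMap.det_id (A := ℝ) (M := Fin (n + 1) → ℝ)]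
    congr 1
    exact LinearMap.ext (reflect_reflect h)
  have habs : |LinearMap.det (reflect α)| = 1 := by
    rcases mul_self_eq_one_iff.1 hdet with h | h <;> simp [h]
  rw [Measure.addHaar_preimage_linearMap _ (by intro h0; simp [h0] at hdet), abs_inv, habs]
  simp

end IntersectionForm

/-- The nef cone truncated at anticanonical degree one. -/
def nefPolytope (n : ℕ) : Set (Fin (n + 1) → ℝ) :=
  {x | x ∈ NefCone n ∧ 0 ≤ interR (antiKR n) x ∧ interR (antiKR n) x ≤ 1}

/-- The pyramid with apex on the ray of `-K` over the facet of the nef cone orthogonal to `E`. -/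
def facetPyramid {n : ℕ} (E : Fin (n + 1) → ℤ) : Set (Fin (n + 1) → ℝ) :=
  {x | x ∈ nefPolytope n ∧ ∀ F : Fin (n + 1) → ℤ, IsMinusOneClass F →
    interR (fun i => (E i : ℝ)) x ≤ interR (fun i => (F i : ℝ)) x}

lemma isClosed_nefCone (n : ℕ) : IsClosed (NefCone n) := by
  simp only [NefCone, Set.ofPred_forall]
  exact isClosed_iInter fun E => isClosed_iInter fun _ =>
    isClosed_le continuous_const (continuous_interR _)

lemma isClosed_facetPyramid {n : ℕ} (E : Fin (n + 1) → ℤ) : IsClosed (facetPyramid E) := by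
  have h : IsClosed {x | ∀ F : Fin (n + 1) → ℤ, IsMinusOneClass F →
      interR (fun i => (E i : ℝ)) x ≤ interR (fun i => (F i : ℝ)) x} := by
    simp only [Set.ofPred_forall]
    exact isClosed_iInter fun F => isClosed_iInter fun _ =>
      isClosed_le (continuous_interR _) (continuous_interR _)
  exact ((isClosed_nefCone n).inter ((isClosed_le continuous_const (continuous_interR _)).inter
    (isClosed_le (continuous_interR _) continuous_const))).inter h

lemma volume_facetPyramid_inter {n : ℕ} {E F : Fin (n + 1) → ℤ} (hE : IsMinusOneClass E)
    (hF : IsMinusOneClass F) (h : E ≠ F) : volume (facetPyramid E ∩ facetPyramid F) = 0 := by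
  set S := LinearMap.ker (interRForm (fun i => (E i : ℝ)) - interRForm (fun i => (F i : ℝ)))
  have hS : S ≠ ⊤ := by
    intro hS
    apply h
    have := eq_of_interR_eq (a := fun i => (E i : ℝ)) (b := fun i => (F i : ℝ)) fun x =>
      sub_eq_zero.1 (LinearMap.mem_ker.1 (hS ▸ Submodule.mem_top : x ∈ S))
    funext i
    exact_mod_cast congrFun this i
  refine measure_mono_null ?_ (Measure.addHaar_submodule volume S hS)
  rintro x ⟨hxE, hxF⟩
  exact LinearMap.mem_ker.2 (sub_eq_zero.2 (le_antisymm (hxE.2 F hF) (hxF.2 E hE)))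

lemma volume_nefPolytope_eq_sum {n : ℕ} (hn : 2 ≤ n) (hn' : n ≤ 6) :
    volume (nefPolytope n) = ∑ E ∈ minusOneClasses n, volume (facetPyramid E) := by
  rw [← measure_biUnion_finset₀]
  · congr 1
    ext x
    simp only [Set.mem_iUnion, exists_prop]
    refine ⟨fun hx => ?_, fun ⟨E, _, hx⟩ => hx.1⟩
    have hne : (minusOneClasses n).Nonempty :=
      ⟨_, Finset.mem_union_left _ (Finset.mem_union_left _
        (Finset.mem_image_of_mem _ (Finset.mem_univ (⟨0, by omega⟩ : Fin n))))⟩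
    obtain ⟨E, hE, hmin⟩ := (minusOneClasses n).exists_min_image
      (fun E => interR (fun i => (E i : ℝ)) x) hne
    exact ⟨E, hE, hx, fun F hF => hmin F ((mem_minusOneClasses hn').2 hF)⟩
  · intro E hE F hF h
    exact volume_facetPyramid_inter ((mem_minusOneClasses hn').1 hE)
      ((mem_minusOneClasses hn').1 hF) h
  · exact fun E _ => (isClosed_facetPyramid E).measurableSet.nullMeasurableSet

lemma reflect_mem_facetPyramid {n : ℕ} {E F : Fin (n + 1) → ℤ} (hE : IsMinusOneClass E)
    (hF : IsMinusOneClass F) (h : interZ E F = 0) {x : Fin (n + 1) → ℝ} (hx : x ∈ facetPyramid E) :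
    reflect (fun i => (E i : ℝ) - F i) x ∈ facetPyramid F := by
  set α : Fin (n + 1) → ℝ := fun i => (E i : ℝ) - F i with hα
  have hα' : α = (fun i => (E i : ℝ)) + (-1 : ℝ) • fun i => (F i : ℝ) := by
    funext i; simp [hα, sub_eq_add_neg]
  have hEF := interR_intCast E F
  have hEE := interR_intCast E E
  have hFF := interR_intCast F F
  have hKE := interR_intCast (antiK n) E
  have hKF := interR_intCast (antiK n) F
  rw [h] at hEF
  rw [hE.1] at hEE
  rw [hF.1] at hFF
  rw [antiK_intCast, hE.2] at hKE
  rw [antiK_intCast, hF.2] at hKF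
  push_cast at hEF hEE hFF hKE hKF
  have hFE := (interR_comm _ _).trans hEF
  have hαα : interR α α = -2 := by
    simp only [hα', interR_add_right, interR_smul_right, interR_add_left, interR_smul_left, hEE,
      hFF, hEF, hFE]
    norm_num
  have hαK : interR α (antiKR n) = 0 := by
    rw [interR_comm, hα', interR_add_right, interR_smul_right, hKE, hKF]
    norm_num
  have hrK : reflect α (antiKR n) = antiKR n := by rw [reflect_apply, hαK]; simp
  have hrF : reflect α (fun i => (F i : ℝ)) = fun i => (E i : ℝ) := by
    rw [reflect_apply]
    nth_rw 1 [hα']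
    rw [interR_add_left, interR_smul_left, hEF, hFF]
    funext i
    simp [hα]
  have hrG : ∀ G : Fin (n + 1) → ℤ, IsMinusOneClass G → ∃ G' : Fin (n + 1) → ℤ,
      IsMinusOneClass G' ∧ reflect α (fun i => (G i : ℝ)) = fun i => (G' i : ℝ) := by
    intro G hG
    have hG' : reflect α (fun i => (G i : ℝ)) =
        fun i => ((G i + (interZ E G - interZ F G) * (E i - F i) : ℤ) : ℝ) := by
      rw [reflect_apply]
      nth_rw 1 [hα']
      rw [interR_add_left, interR_smul_left, interR_intCast, interR_intCast]
      funext i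
      simp [hα, sub_eq_add_neg]
    refine ⟨_, ⟨?_, ?_⟩, hG'⟩
    · have := interR_intCast G G
      rw [hG.1, ← reflect_reflect hαα (fun i => (G i : ℝ)), ← interR_reflect,
        reflect_reflect hαα, hG', interR_intCast] at this
      exact_mod_cast this
    · have := interR_intCast (antiK n) G
      rw [hG.2, antiK_intCast, ← hrK, ← interR_reflect, hG', ← antiK_intCast,
        interR_intCast] at this
      exact_mod_cast this
  refine ⟨⟨fun G hG => ?_, ?_⟩, fun G hG => ?_⟩
  · obtain ⟨G', hG', h⟩ := hrG G hG
    rw [interR_reflect, h]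
    exact hx.1.1 G' hG'
  · rw [interR_reflect, hrK]
    exact hx.1.2
  · obtain ⟨G', hG', h⟩ := hrG G hG
    rw [interR_reflect, interR_reflect, h, hrF]
    exact hx.2 G' hG'

lemma volume_facetPyramid_eq {n : ℕ} {E F : Fin (n + 1) → ℤ} (hE : IsMinusOneClass E)
    (hF : IsMinusOneClass F) (h : interZ E F = 0) :
    volume (facetPyramid E) = volume (facetPyramid F) := by
  have key : ∀ {E F : Fin (n + 1) → ℤ}, IsMinusOneClass E → IsMinusOneClass F →
      interZ E F = 0 → volume (facetPyramid E) ≤ volume (facetPyramid F) := by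
    intro E F hE hF h
    rw [← volume_preimage_reflect (α := fun i => (E i : ℝ) - F i) ?_ (facetPyramid F)]
    · exact measure_mono fun x hx => reflect_mem_facetPyramid hE hF h hx
    · have := interR_intCast (E - F) (E - F)
      simp only [Pi.sub_apply, Int.cast_sub] at this
      rw [this]
      have : interZ (E - F) (E - F) = interZ E E - 2 * interZ E F + interZ F F := by
        simp only [interZ, Pi.sub_apply, sub_mul, mul_sub, Finset.sum_sub_distrib, mul_comm (F _)]
        ring
      rw [this, h, hE.1, hF.1]
      norm_num
  refine (key hE hF h).antisymm (key hF hE ?_)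
  rw [← h]
  simp only [interZ, mul_comm, mul_left_comm]

section LastExceptional

variable {m : ℕ}

lemma interR_init (F x : Fin (m + 2) → ℝ) :
    interR (fun i : Fin (m + 1) => F i.castSucc) (fun i => x i.castSucc) =
      interR F x + F (Fin.last _) * x (Fin.last _) := by
  simp only [interR, Fin.sum_univ_castSucc, Fin.castSucc_zero]
  ring

lemma interZ_init (F G : Fin (m + 2) → ℤ) :
    interZ (fun i : Fin (m + 1) => F i.castSucc) (fun i => G i.castSucc) =
      interZ F G + F (Fin.last _) * G (Fin.last _) := by
  simp only [interZ, Fin.sum_univ_castSucc, Fin.castSucc_zero]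
  ring

lemma antiK_castSucc : (fun i : Fin (m + 1) => antiK (m + 1) i.castSucc) = antiK m := by
  funext i
  simp [antiK, Fin.castSucc_eq_zero_iff]

lemma antiKR_castSucc : (fun i : Fin (m + 1) => antiKR (m + 1) i.castSucc) = antiKR m := by
  funext i
  simp [antiKR, Fin.castSucc_eq_zero_iff]

lemma interR_antiKR_self (n : ℕ) : interR (antiKR n) (antiKR n) = 9 - n := by
  simp [interR, antiKR, Fin.sum_univ_succ]
  ring

lemma isMinusOneClass_snoc {G : Fin (m + 1) → ℤ} (hG : IsMinusOneClass G) :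
    IsMinusOneClass (Fin.snoc G 0 : Fin (m + 2) → ℤ) := by
  have h : (fun i : Fin (m + 1) => (Fin.snoc G 0 : Fin (m + 2) → ℤ) i.castSucc) = G := by
    funext i; simp
  constructor
  · simpa [h, hG.1] using (interZ_init (Fin.snoc G 0) (Fin.snoc G 0)).symm
  · simpa [h, antiK_castSucc, hG.2] using (interZ_init (antiK (m + 1)) (Fin.snoc G 0)).symm

/-- The projection along `-K` to the hyperplane orthogonal to the last exceptional class. -/
lemma interR_project {F : Fin (m + 2) → ℤ} (hF : IsMinusOneClass F) (x : Fin (m + 2) → ℝ) :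
    interR (fun i : Fin (m + 1) => (F i.castSucc : ℝ))
        (fun i => x i.castSucc + x (Fin.last _) * antiKR m i) =
      interR (fun i => (F i : ℝ)) x + x (Fin.last _) := by
  have h₁ := interR_init (fun i => (F i : ℝ)) x
  have h₂ := interR_init (fun i => (F i : ℝ)) (antiKR (m + 1))
  have h₃ := interR_intCast (antiK (m + 1)) F
  rw [hF.2, antiK_intCast, interR_comm] at h₃
  rw [antiKR_castSucc, h₃] at h₂
  change interR _ ((fun i : Fin (m + 1) => x i.castSucc) + x (Fin.last _) • antiKR m) = _
  rw [interR_add_right, interR_smul_right, h₁, h₂]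
  simp [antiKR, Fin.last_eq_zero_iff]
  ring

lemma interR_antiKR_project (x : Fin (m + 2) → ℝ) :
    interR (antiKR m) (fun i => x i.castSucc + x (Fin.last _) * antiKR m i) =
      interR (antiKR (m + 1)) x + (8 - m) * x (Fin.last _) := by
  have h₁ := interR_init (antiKR (m + 1)) x
  rw [antiKR_castSucc] at h₁
  change interR _ ((fun i : Fin (m + 1) => x i.castSucc) + x (Fin.last _) • antiKR m) = _
  rw [interR_add_right, interR_smul_right, h₁, interR_antiKR_self]
  simp [antiKR, Fin.last_eq_zero_iff]
  ring

lemma isMinusOneClass_single_last (m : ℕ) :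
    IsMinusOneClass (Pi.single (Fin.last (m + 1)) 1 : Fin (m + 2) → ℤ) := by
  simp [IsMinusOneClass, interZ, antiK, Pi.single_apply, Fin.last_eq_zero_iff]

lemma interR_single_last (x : Fin (m + 2) → ℝ) :
    interR (fun i => ((Pi.single (Fin.last (m + 1)) 1 : Fin (m + 2) → ℤ) i : ℝ)) x =
      -x (Fin.last _) := by
  simp [interR, Pi.single_apply]

lemma minusOneClass_init (hm : 2 ≤ m) (hm' : m ≤ 5) :
    ∀ F ∈ minusOneClasses (m + 1), F = Pi.single (Fin.last _) 1 ∨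
      (fun i : Fin (m + 1) => F i.castSucc) ∈ minusOneClasses m ∨
      ∃ A ∈ minusOneClasses m, ∃ B ∈ minusOneClasses m,
        (fun i : Fin (m + 1) => F i.castSucc) = A + B := by
  interval_cases m <;> decide +kernel

lemma minusOneClass_chain (hm : 2 ≤ m) (hm' : m ≤ 5) :
    ∀ F ∈ minusOneClasses (m + 1), F = Pi.single (Fin.last _) 1 ∨
      interZ F (Pi.single (Fin.last _) 1) = 0 ∨
      ∃ G ∈ minusOneClasses (m + 1), interZ F G = 0 ∧
        interZ G (Pi.single (Fin.last _) 1) = 0 := by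
  interval_cases m <;> decide +kernel

lemma interR_antiKR_nonneg (hm : 2 ≤ m) (hm' : m ≤ 5) {x : Fin (m + 1) → ℝ}
    (hx : x ∈ NefCone m) : 0 ≤ interR (antiKR m) x := by
  interval_cases m
  · have h₁ := hx ![0, 1, 0] ⟨by decide, by decide⟩
    have h₂ := hx ![0, 0, 1] ⟨by decide, by decide⟩
    have h₃ := hx ![1, -1, -1] ⟨by decide, by decide⟩
    simp [interR, antiKR, Fin.sum_univ_succ] at h₁ h₂ h₃ ⊢
    linarith
  · have h₁ := hx ![1, -1, -1, 0] ⟨by decide, by decide⟩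
    have h₂ := hx ![1, -1, 0, -1] ⟨by decide, by decide⟩
    have h₃ := hx ![1, 0, -1, -1] ⟨by decide, by decide⟩
    have h₄ := hx ![0, 1, 0, 0] ⟨by decide, by decide⟩
    have h₅ := hx ![0, 0, 1, 0] ⟨by decide, by decide⟩
    have h₆ := hx ![0, 0, 0, 1] ⟨by decide, by decide⟩
    simp [interR, antiKR, Fin.sum_univ_succ] at h₁ h₂ h₃ h₄ h₅ h₆ ⊢
    linarith
  · have h₁ := hx ![1, -1, -1, 0, 0] ⟨by decide, by decide⟩
    have h₂ := hx ![1, 0, 0, -1, -1] ⟨by decide, by decide⟩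
    have h₃ := hx ![0, 1, 0, 0, 0] ⟨by decide, by decide⟩
    have h₄ := hx ![0, 0, 1, 0, 0] ⟨by decide, by decide⟩
    simp [interR, antiKR, Fin.sum_univ_succ] at h₁ h₂ h₃ h₄ ⊢
    linarith
  · have h₁ := hx ![2, -1, -1, -1, -1, -1] ⟨by decide, by decide⟩
    have h₂ := hx ![1, -1, -1, 0, 0, 0] ⟨by decide, by decide⟩
    have h₃ := hx ![0, 1, 0, 0, 0, 0] ⟨by decide, by decide⟩
    have h₄ := hx ![0, 0, 1, 0, 0, 0] ⟨by decide, by decide⟩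
    simp [interR, antiKR, Fin.sum_univ_succ] at h₁ h₂ h₃ h₄ ⊢
    linarith

lemma mem_facetPyramid_single_last (hm : 2 ≤ m) (hm' : m ≤ 5) (x : Fin (m + 2) → ℝ) :
    x ∈ facetPyramid (Pi.single (Fin.last (m + 1)) 1) ↔ x (Fin.last _) ≤ 0 ∧
      (fun i => x i.castSucc + x (Fin.last _) * antiKR m i) ∈ NefCone m ∧
      interR (antiKR m) (fun i => x i.castSucc + x (Fin.last _) * antiKR m i) ≤
        1 + (8 - m) * x (Fin.last _) := by
  constructor
  · rintro ⟨⟨hnef, -, h1⟩, hmin⟩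
    refine ⟨?_, fun G hG => ?_, ?_⟩
    · have := hnef _ (isMinusOneClass_single_last m)
      rw [interR_single_last] at this
      linarith
    · have h := interR_project (isMinusOneClass_snoc hG) x
      have h' := hmin _ (isMinusOneClass_snoc hG)
      simp only [Fin.snoc_castSucc] at h
      rw [interR_single_last] at h'
      rw [h]
      linarith
    · rw [interR_antiKR_project]
      linarith
  · rintro ⟨h0, hnef, h1⟩
    have hmin : ∀ F : Fin (m + 2) → ℤ, IsMinusOneClass F →
        -x (Fin.last _) ≤ interR (fun i => (F i : ℝ)) x := by
      intro F hF
      have hp := interR_project hF x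
      rcases minusOneClass_init hm hm' F ((mem_minusOneClasses (by omega)).2 hF) with
        rfl | h | ⟨A, hA, B, hB, h⟩
      · rw [interR_single_last]
      · have := hnef _ ((mem_minusOneClasses (by omega)).1 h)
        linarith
      · have hA' := hnef A ((mem_minusOneClasses (by omega)).1 hA)
        have hB' := hnef B ((mem_minusOneClasses (by omega)).1 hB)
        have h' : (fun i : Fin (m + 1) => (F i.castSucc : ℝ)) =
            (fun i => (A i : ℝ)) + fun i => (B i : ℝ) := by
          funext i
          simpa using congrArg (Int.cast : ℤ → ℝ) (congrFun h i)
        rw [h', interR_add_left] at hp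
        linarith
    have hpos := interR_antiKR_nonneg hm hm' hnef
    rw [interR_antiKR_project] at h1 hpos
    have hm8 : (m : ℝ) ≤ 5 := by exact_mod_cast hm'
    refine ⟨⟨fun F hF => (neg_nonneg.2 h0).trans (hmin F hF), ?_, by linarith⟩, fun F hF => ?_⟩
    · nlinarith
    · rw [interR_single_last]
      exact hmin F hF

lemma volume_facetPyramid_single_last (hm : 2 ≤ m) (hm' : m ≤ 5) :
    volume (facetPyramid (Pi.single (Fin.last (m + 1)) 1)) =
      ENNReal.ofReal (1 / ((8 - m) * (m + 2))) * volume (nefPolytope m) := by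
  have hm8 : (m : ℝ) ≤ 5 := by exact_mod_cast hm'
  have hV : nefPolytope m = {y | y ∈ NefCone m ∧ interR (antiKR m) y ≤ 1} := by
    ext y
    exact ⟨fun h => ⟨h.1, h.2.2⟩, fun h => ⟨h.1, interR_antiKR_nonneg hm hm' h.1, h.2⟩⟩
  have := volume_pyramid (isClosed_nefCone m).measurableSet (l := interR (antiKR m))
    (fun s hs y hy E hE => by rw [interR_smul_right]; exact mul_nonneg hs.le (hy E hE))
    (continuous_interR _).measurable (interR_smul_right _)
    (fun y hy => interR_antiKR_nonneg hm hm' hy) (antiKR m) (c := 8 - m) (by linarith)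
  rw [hV, show ((m : ℝ) + 2) = ((m + 1 : ℕ) : ℝ) + 1 by push_cast; ring, ← this]
  congr 1
  ext x
  exact mem_facetPyramid_single_last hm hm' x

theorem volume_nefPolytope_succ (hm : 2 ≤ m) (hm' : m ≤ 5) :
    volume (nefPolytope (m + 1)) = (minusOneClasses (m + 1)).card *
      (ENNReal.ofReal (1 / ((8 - m) * (m + 2))) * volume (nefPolytope m)) := by
  rw [volume_nefPolytope_eq_sum (by omega) (by omega),
    ← volume_facetPyramid_single_last hm hm', ← nsmul_eq_mul]
  refine Finset.sum_eq_card_nsmul fun F hF => ?_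
  have hF' := (mem_minusOneClasses (by omega)).1 hF
  have hE := isMinusOneClass_single_last m
  rcases minusOneClass_chain hm hm' F hF with rfl | h | ⟨G, hG, h₁, h₂⟩
  · rfl
  · exact volume_facetPyramid_eq hF' hE h
  · have hG' := (mem_minusOneClasses (by omega)).1 hG
    exact (volume_facetPyramid_eq hF' hG' h₁).trans (volume_facetPyramid_eq hG' hE h₂)

end LastExceptional

lemma volume_nefPolytope_two : volume (nefPolytope 2) = ENNReal.ofReal (1 / 72) := by
  have hC : MeasurableSet {y : Fin 2 → ℝ | y 1 ≤ 0 ∧ 0 ≤ y 0 + y 1} :=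
    (measurableSet_le (f := fun y : Fin 2 → ℝ => y 1) (by fun_prop) measurable_const).inter
      (measurableSet_le (g := fun y : Fin 2 → ℝ => y 0 + y 1) measurable_const (by fun_prop))
  have hC' : MeasurableSet {y : Fin 1 → ℝ | 0 ≤ y 0} :=
    measurableSet_le (by fun_prop) (by fun_prop)
  have h₃ : nefPolytope 2 = {x : Fin 3 → ℝ | x 2 ≤ 0 ∧
      (x 1 ≤ 0 ∧ 0 ≤ x 0 + x 2 + x 1) ∧ 3 * (x 0 + x 2) + x 1 ≤ 1 + 2 * x 2} := by
    have hmem : minusOneClasses 2 = {![0, 1, 0], ![0, 0, 1], ![1, -1, -1]} := by decide +kernel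
    ext x
    simp only [nefPolytope, NefCone, ← mem_minusOneClasses (show 2 ≤ 6 by norm_num), hmem,
      Finset.mem_insert, Finset.mem_singleton, forall_eq_or_imp, forall_eq, Set.mem_ofPred_eq]
    simp [interR, antiKR, Fin.sum_univ_succ]
    constructor
    · rintro ⟨⟨h₁, h₂, h₃⟩, h₄, h₅⟩
      refine ⟨?_, ⟨?_, ?_⟩, ?_⟩ <;> linarith
    · rintro ⟨h₁, ⟨h₂, h₃⟩, h₄⟩
      refine ⟨⟨?_, ?_, ?_⟩, ?_, ?_⟩ <;> linarith
  have v₃ := volume_pyramid hC (l := fun y => 3 * y 0 + y 1)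
    (fun s hs y hy => ⟨by simpa using mul_nonpos_of_nonneg_of_nonpos hs.le hy.1,
      by simpa [mul_add] using mul_nonneg hs.le hy.2⟩) (by fun_prop)
    (fun s y => by simp; ring) (fun y hy => by linarith [hy.1, hy.2]) ![1, 0]
    (c := 2) (by norm_num)
  have v₂ := volume_pyramid hC' (l := fun y => 3 * y 0)
    (fun s hs y hy => by simpa using mul_nonneg hs.le hy) (by fun_prop)
    (fun s y => by simp; ring) (fun y hy => mul_nonneg (by norm_num) hy) ![1]
    (c := 2) (by norm_num)
  have v₁ : volume {y : Fin 1 → ℝ | y ∈ {y : Fin 1 → ℝ | 0 ≤ y 0} ∧ 3 * y 0 ≤ 1} =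
      ENNReal.ofReal (1 / 3) := by
    have : {y : Fin 1 → ℝ | y ∈ {y : Fin 1 → ℝ | 0 ≤ y 0} ∧ 3 * y 0 ≤ 1} =
        Set.Icc (fun _ => 0) (fun _ => 1 / 3) := by
      ext y
      simp only [Set.mem_ofPred_eq, Set.mem_Icc, Pi.le_def, Fin.forall_fin_one]
      refine and_congr_right fun _ => ?_
      rw [le_div_iff₀ (by norm_num), mul_comm]
    rw [this, Real.volume_Icc_pi]
    simp
  have h₂ : {y : Fin 2 → ℝ | y ∈ {y : Fin 2 → ℝ | y 1 ≤ 0 ∧ 0 ≤ y 0 + y 1} ∧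
      3 * y 0 + y 1 ≤ 1} = {y : Fin 2 → ℝ | y 1 ≤ 0 ∧ 0 ≤ y 0 + y 1 ∧
        3 * (y 0 + y 1) ≤ 1 + 2 * y 1} := by
    ext y
    simp only [Set.mem_ofPred_eq, and_assoc]
    refine and_congr_right fun _ => and_congr_right fun _ => ?_
    constructor <;> intro h <;> linarith
  rw [h₃]
  refine (congrArg volume ?_).trans (v₃.trans ?_)
  · ext x
    simp [Fin.last]
  rw [h₂]
  refine (congrArg (_ * volume ·) ?_).trans ((congrArg (_ * ·) (v₂.trans (congrArg _ v₁))).trans ?_)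
  · ext x
    simp [Fin.last]
  rw [← ENNReal.ofReal_mul (by norm_num), ← ENNReal.ofReal_mul (by norm_num)]
  norm_num

theorem alpha_S6 :
    7 * (volume {x : Fin (6 + 1) → ℝ | x ∈ NefCone 6 ∧
      0 ≤ interR (antiKR 6) x ∧ interR (antiKR 6) x ≤ 1}).toReal = 1 / 120 := by
  have c₃ : (minusOneClasses 3).card = 6 := by decide +kernel
  have c₄ : (minusOneClasses 4).card = 10 := by decide +kernel
  have c₅ : (minusOneClasses 5).card = 16 := by decide +kernel
  have c₆ : (minusOneClasses 6).card = 27 := by decide +kernel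
  have h : (volume (nefPolytope 6)).toReal = 1 / 840 := by
    rw [volume_nefPolytope_succ (m := 5) (by norm_num) (by norm_num),
      volume_nefPolytope_succ (m := 4) (by norm_num) (by norm_num),
      volume_nefPolytope_succ (m := 3) (by norm_num) (by norm_num),
      volume_nefPolytope_succ (m := 2) (by norm_num) (by norm_num), volume_nefPolytope_two,
      c₃, c₄, c₅, c₆]
    simp only [ENNReal.toReal_mul, ENNReal.toReal_natCast]
    repeat rw [ENNReal.toReal_ofReal (by norm_num)]
    norm_num
  change 7 * (volume (nefPolytope 6)).toReal = _
  rw [h]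
  norm_num
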